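/- arXiv:2209.05006 — 2 statements merged into one kernel-verified Lean document; each statement's English description precedes it below -/
import Mathlib

section
/- Let A be a commutative ring, I an ideal of A, and l ≥ 1 an integer. Let x_1,…,x_l, x'_1,…,x'_l ∈ A and y_1,…,y_l ∈ I, and for each s set M_s = [[x_s, -x_s·x'_s + y_s],[1, -x'_s]] (a 2×2 matrix over A). Then every entry of the matrix M_l·M_{l-1}⋯M_1 − (∏_{s=1}^{l-1}(x_s − x'_{s+1}))·[[x_l, −x_l·x'_1],[1, −x'_1]] lies in I. -/
/-- Let `A` be a commutative ring, `I` an ideal of `A`, and `l ≥ 1`.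
Given `x s, x' s ∈ A` and `y s ∈ I` for `s = 1, …, l`, set
`M s = !![x s, -(x s * x' s) + y s; 1, -(x' s)]`.  Then every entry of
`M l * M (l-1) * ⋯ * M 1 - (∏_{s=1}^{l-1} (x s - x' (s+1))) • !![x l, -(x l * x' 1); 1, -(x' 1)]`
lies in `I`. -/
theorem matrix_product_congruence
    (A : Type*) [CommRing A] (I : Ideal A) (l : ℕ) (hl : 1 ≤ l)
    (x x' y : ℕ → A) (hy : ∀ s, 1 ≤ s → s ≤ l → y s ∈ I)
    (M : ℕ → Matrix (Fin 2) (Fin 2) A)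
    (hM : ∀ s, M s = !![x s, -(x s * x' s) + y s; 1, -(x' s)]) :
    ∀ i j : Fin 2,
      ((((List.range l).map (fun t => M (l - t))).prod
          - (∏ s ∈ Finset.Ico 1 l, (x s - x' (s + 1))) •
            !![x l, -(x l * x' 1); 1, -(x' 1)]) i j) ∈ I := by
  induction l, hl using Nat.le_induction with
  | base =>
    have h := hy 1 le_rfl le_rfl
    intro i j
    fin_cases i <;> fin_cases j <;> simp [hM, h]
  | succ l hl ih =>
    have hyl := hy (l + 1) (by omega) le_rfl
    replace ih := ih fun s h1 h2 => hy s h1 (by omega)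
    have hprod : ((List.range (l + 1)).map (fun t => M (l + 1 - t))).prod
        = M (l + 1) * ((List.range l).map (fun t => M (l - t))).prod := by
      simp [List.range_succ_eq_map, Function.comp_def]
    rw [hprod, Finset.prod_Ico_succ_top hl, hM (l + 1)]
    generalize ((List.range l).map (fun t => M (l - t))).prod = P at ih ⊢
    generalize ∏ s ∈ Finset.Ico 1 l, (x s - x' (s + 1)) = c at ih ⊢
    intro i j
    have h0 := ih 0 j
    have h1 := ih 1 j
    fin_cases i
    · convert I.add_mem (I.sub_mem (I.mul_mem_left (x (l + 1)) h0)
        (I.mul_mem_left (x (l + 1) * x' (l + 1)) h1)) (I.mul_mem_right (P 1 j) hyl) using 1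
      fin_cases j <;> simp [Matrix.vecMul, dotProduct, Fin.sum_univ_two] <;> ring
    · convert I.sub_mem h0 (I.mul_mem_left (x' (l + 1)) h1) using 1
      fin_cases j <;> simp [Matrix.vecMul, dotProduct, Fin.sum_univ_two] <;> ring
end

section
/- Let A be a commutative ring and I an ideal of A such that A is Henselian with respect to I. Let τ be a unit of A, let a, b ∈ A with a − b a unit of A, and let M be a 2×2 matrix over A all of whose entries are congruent modulo I to the corresponding entries of τ·[[a, −a·b],[1, −b]]. Then the trace of M is a unit of A, det(M) ∈ I, and there exist λ, λ' ∈ A with λ + λ' = trace(M), λ·λ' = det(M), such that λ is a unit of A, λ − τ·(a − b) ∈ I, λ' ∈ I, and the ratio λ'·λ⁻¹ lies in I. -/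
open Polynomial in
/-- Over a ring Henselian at `I`, a monic quadratic `X² - t X + d` with `t` a unit and `d ∈ I`
has a root congruent to `t` modulo `I`. -/
theorem HenselianRing.exists_root_quadratic {A : Type*} [CommRing A] (I : Ideal A)
    [HenselianRing A I] {t d : A} (ht : IsUnit t) (hd : d ∈ I) :
    ∃ r : A, r * r - t * r + d = 0 ∧ r - t ∈ I := by
  have hmonic : (X ^ 2 - C t * X + C d : A[X]).Monic := by
    monicity!
  obtain ⟨r, hr, hrt⟩ := HenselianRing.is_henselian (I := I) (X ^ 2 - C t * X + C d) hmonic t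
    (by simpa [pow_two] using hd)
    (by
      have h : (X ^ 2 - C t * X + C d : A[X]).derivative.eval t = t := by
        simp
        ring
      rw [h]
      exact ht.map _)
  refine ⟨r, ?_, hrt⟩
  simpa [Polynomial.IsRoot, pow_two] using hr

/-- An element congruent to a unit modulo an ideal inside the Jacobson radical is a unit. -/
theorem IsUnit.of_sub_mem_of_le_jacobson_bot {A : Type*} [CommRing A] {I : Ideal A}
    (hI : I ≤ Ideal.jacobson ⊥) {u x : A} (hu : IsUnit u) (hx : x - u ∈ I) : IsUnit x := by
  obtain ⟨v, rfl⟩ := hu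
  have h := (Ideal.mem_jacobson_bot.mp (hI hx) (↑v⁻¹ : A)).mul v.isUnit
  have hxv : ((x - v) * (↑v⁻¹ : A) + 1) * v = x := by
    linear_combination (x - v) * v.inv_mul
  rwa [hxv] at h


/-- Let `A` be Henselian with respect to the ideal `I`, let `τ` be a unit,
`a - b` a unit, and `M` a `2 × 2` matrix over `A` congruent entrywise modulo `I` to
`τ • !![a, -(a*b); 1, -b]`.  Then `trace M` is a unit, `det M ∈ I`, and there are eigenvalues
`lam, lam'` with `lam + lam' = trace M`, `lam * lam' = det M`, `lam` a unit,
`lam - τ*(a - b) ∈ I`, `lam' ∈ I`, and the multiplier `lam' * lam⁻¹ ∈ I`. -/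
theorem henselian_multiplier
    (A : Type*) [CommRing A] (I : Ideal A) [HenselianRing A I]
    (τ a b : A) (hτ : IsUnit τ) (hab : IsUnit (a - b))
    (M : Matrix (Fin 2) (Fin 2) A)
    (hM : ∀ i j : Fin 2, (M - τ • !![a, -(a * b); 1, -b]) i j ∈ I) :
    IsUnit M.trace ∧ M.det ∈ I ∧
      ∃ lam lam' : A,
        lam + lam' = M.trace ∧
        lam * lam' = M.det ∧
        IsUnit lam ∧
        lam - τ * (a - b) ∈ I ∧
        lam' ∈ I ∧
        lam' * Ring.inverse lam ∈ I := by
  have hI : I ≤ Ideal.jacobson ⊥ := HenselianRing.jac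
  have h00 : M 0 0 - τ * a ∈ I := by simpa using hM 0 0
  have h01 : M 0 1 + τ * (a * b) ∈ I := by simpa using hM 0 1
  have h10 : M 1 0 - τ ∈ I := by simpa using hM 1 0
  have h11 : M 1 1 + τ * b ∈ I := by simpa using hM 1 1
  have htr : M.trace - τ * (a - b) ∈ I := by
    have h := I.add_mem h00 h11
    rw [Matrix.trace_fin_two]
    convert h using 1
    ring
  have hdet : M.det ∈ I := by
    have h := I.sub_mem
      (I.add_mem (I.mul_mem_left (M 1 1) h00) (I.mul_mem_left (τ * a) h11))
      (I.sub_mem (I.mul_mem_left (M 1 0) h01) (I.mul_mem_left (τ * (a * b)) h10))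
    rw [Matrix.det_fin_two]
    convert h using 1
    ring
  have hu : IsUnit M.trace := (hτ.mul hab).of_sub_mem_of_le_jacobson_bot hI htr
  obtain ⟨r, hr, hrt⟩ := HenselianRing.exists_root_quadratic I hu hdet
  have hr' : M.trace - r ∈ I := by simpa using I.neg_mem hrt
  refine ⟨hu, hdet, r, M.trace - r, by ring, by linear_combination -hr,
    hu.of_sub_mem_of_le_jacobson_bot hI hrt, ?_, hr', I.mul_mem_right _ hr'⟩
  simpa using I.add_mem hrt htr
end
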